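/- (Descent lemma for the generalized coordinate step.) Let f : X → ℝ be differentiable with block-i Lipschitz continuous gradient with constant L_i > 0, let g_1, …, g_N be convex real-valued functions on the respective blocks, and let Q_i be a self-adjoint linear map on E_i satisfying ⟪Q_i s, s⟫ ≥ L_i ‖s‖² for all s ∈ E_i. If x ∈ X and d_i ∈ E_i minimizes s ↦ q_i(s; x) over E_i, then V(x +_i d_i) ≤ V(x) − (L_i/2)‖d_i‖². -/

import Mathlib

open scoped RealInnerProductSpace

/-- The block gradient `∇_i f(x) ∈ E i`: the gradient at `x i` of the map
`t ↦ f (x with i-th block replaced by t)`. -/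
noncomputable def blockGrad {N : ℕ} {E : Fin N → Type*} [∀ i, NormedAddCommGroup (E i)]
    [∀ i, InnerProductSpace ℝ (E i)] [∀ i, FiniteDimensional ℝ (E i)]
    (f : (∀ i, E i) → ℝ) (i : Fin N) (x : ∀ i, E i) : E i :=
  gradient (fun t => f (Function.update x i t)) (x i)

/-- The local quadratic approximation
`q_i(s; x) := ⟪∇_i f(x), s⟫ + (1/2)⟪Q s, s⟫ + g (x_i + s)`. -/
noncomputable def qApprox {N : ℕ} {E : Fin N → Type*} [∀ i, NormedAddCommGroup (E i)]
    [∀ i, InnerProductSpace ℝ (E i)] [∀ i, FiniteDimensional ℝ (E i)]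
    (f : (∀ i, E i) → ℝ) (i : Fin N) (g : E i → ℝ) (Q : E i →ₗ[ℝ] E i)
    (x : ∀ i, E i) (s : E i) : ℝ :=
  ⟪blockGrad f i x, s⟫ + (1 / 2) * ⟪Q s, s⟫ + g (x i + s)

/-- Quadratic upper bound along a segment for a differentiable function whose gradient is
Lipschitz relative to the base point. -/
theorem le_add_inner_gradient_add_sq {F : Type*} [NormedAddCommGroup F] [InnerProductSpace ℝ F]
    [CompleteSpace F] {φ : F → ℝ} (hφ : Differentiable ℝ φ) {L : ℝ} {a : F}
    (hlip : ∀ s, ‖gradient φ (a + s) - gradient φ a‖ ≤ L * ‖s‖) (d : F) :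
    φ (a + d) ≤ φ a + ⟪gradient φ a, d⟫ + L / 2 * ‖d‖ ^ 2 := by
  let ψ : ℝ → ℝ := fun t =>
    φ (a + t • d) - t * ⟪gradient φ a, d⟫ - L / 2 * t ^ 2 * ‖d‖ ^ 2
  have hψ : ∀ t, HasDerivAt ψ
      (⟪gradient φ (a + t • d) - gradient φ a, d⟫ - L * t * ‖d‖ ^ 2) t := by
    intro t
    have hline : HasDerivAt (fun t : ℝ => a + t • d) d t := by
      simpa using ((hasDerivAt_id t).smul_const d).const_add a
    have hcomp := (hφ (a + t • d)).hasGradientAt.hasFDerivAt.comp_hasDerivAt t hline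
    have hlin := (hasDerivAt_id t).mul_const ⟪gradient φ a, d⟫
    have hsq := (((hasDerivAt_id t).pow 2).const_mul (L / 2)).mul_const (‖d‖ ^ 2)
    refine ((hcomp.sub hlin).sub hsq).congr_deriv ?_
    simp only [InnerProductSpace.toDual_apply_apply, inner_sub_left, id]
    push_cast
    ring
  have hanti : AntitoneOn ψ (Set.Icc 0 1) := by
    refine antitoneOn_of_deriv_nonpos (convex_Icc 0 1)
      (fun t _ => (hψ t).continuousAt.continuousWithinAt)
      (fun t _ => (hψ t).differentiableAt.differentiableWithinAt) fun t ht => ?_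
    rw [interior_Icc] at ht
    have hbound : ⟪gradient φ (a + t • d) - gradient φ a, d⟫ ≤ L * (t * ‖d‖) * ‖d‖ := by
      refine (real_inner_le_norm _ _).trans (mul_le_mul_of_nonneg_right ?_ (norm_nonneg d))
      simpa [norm_smul, abs_of_pos ht.1] using hlip (t • d)
    rw [(hψ t).deriv]
    linarith
  have h := hanti (Set.left_mem_Icc.2 zero_le_one) (Set.right_mem_Icc.2 zero_le_one) zero_le_one
  simp only [ψ, one_smul, zero_smul, add_zero] at h
  linarith

/-- First-order optimality for a minimizer `d` of a quadratic model plus a convex function,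
tested against the zero step. -/
theorem inner_add_sub_le_neg_of_forall_le {F : Type*} [NormedAddCommGroup F]
    [InnerProductSpace ℝ F] {g : F → ℝ} (hg : ConvexOn ℝ Set.univ g) (Q : F →ₗ[ℝ] F) {v a d : F}
    (hd : ∀ s, ⟪v, d⟫ + (1 / 2) * ⟪Q d, d⟫ + g (a + d) ≤
      ⟪v, s⟫ + (1 / 2) * ⟪Q s, s⟫ + g (a + s)) :
    ⟪v, d⟫ + g (a + d) - g a ≤ -⟪Q d, d⟫ := by
  have key : ∀ t ∈ Set.Ioo (0 : ℝ) 1,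
      ⟪v, d⟫ + g (a + d) - g a + (1 + t) / 2 * ⟪Q d, d⟫ ≤ 0 := by
    intro t ht
    have hmin := hd (t • d)
    have hconv := hg.2 (Set.mem_univ a) (Set.mem_univ (a + d)) (sub_nonneg.2 ht.2.le) ht.1.le
      (sub_add_cancel 1 t)
    have hpt : (1 - t) • a + t • (a + d) = a + t • d := by module
    rw [hpt] at hconv
    simp only [smul_eq_mul] at hconv
    simp only [map_smul, real_inner_smul_left, real_inner_smul_right] at hmin
    refine le_of_mul_le_mul_left ?_ (sub_pos.2 ht.2)
    linarith
  have hlim : Filter.Tendsto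
      (fun t : ℝ => ⟪v, d⟫ + g (a + d) - g a + (1 + t) / 2 * ⟪Q d, d⟫)
      (nhdsWithin 1 (Set.Iio 1))
      (nhds (⟪v, d⟫ + g (a + d) - g a + (1 + 1) / 2 * ⟪Q d, d⟫)) :=
    Filter.Tendsto.mono_left (Continuous.tendsto (by fun_prop) 1) nhdsWithin_le_nhds
  have h := le_of_tendsto hlim
    (Filter.eventually_of_mem (Ioo_mem_nhdsLT (zero_lt_one' ℝ)) key)
  linarith

/-- Descent lemma for the generalized coordinate step: if `d_i` minimizes `q_i(·; x)` then
`V(x +_i d_i) ≤ V(x) − (L_i/2)‖d_i‖²`. -/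
theorem stmt7 {N : ℕ} (hN : 1 ≤ N) {E : Fin N → Type*} [∀ i, NormedAddCommGroup (E i)]
    [∀ i, InnerProductSpace ℝ (E i)] [∀ i, FiniteDimensional ℝ (E i)]
    (f : (∀ i, E i) → ℝ) (hf : Differentiable ℝ f) (i : Fin N) (Li : ℝ) (hLi : 0 < Li)
    (hlip : ∀ (x : ∀ i, E i) (s : E i),
      ‖blockGrad f i (Function.update x i (x i + s)) - blockGrad f i x‖ ≤ Li * ‖s‖)
    (g : ∀ j, E j → ℝ) (hg : ∀ j, ConvexOn ℝ Set.univ (g j))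
    (Q : E i →ₗ[ℝ] E i) (hQsym : Q.IsSymmetric)
    (hQ : ∀ s : E i, Li * ‖s‖ ^ 2 ≤ ⟪Q s, s⟫)
    (x : ∀ i, E i) (di : E i)
    (hdi : ∀ s : E i, qApprox f i (g i) Q x di ≤ qApprox f i (g i) Q x s) :
    (f (Function.update x i (x i + di)) + ∑ j, g j (Function.update x i (x i + di) j)) ≤
      (f x + ∑ j, g j (x j)) - Li / 2 * ‖di‖ ^ 2 := by
  have hφ : Differentiable ℝ fun t => f (Function.update x i t) :=
    hf.comp fun t => (hasFDerivAt_update x t).differentiableAt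
  have hdesc := le_add_inner_gradient_add_sq hφ (L := Li) (a := x i)
    (fun s => by simpa [blockGrad] using hlip x s) di
  have hopt := inner_add_sub_le_neg_of_forall_le (hg i) Q (a := x i) hdi
  have hsum : ∑ j, g j (Function.update x i (x i + di) j) - ∑ j, g j (x j) =
      g i (x i + di) - g i (x i) := by
    rw [← Finset.sum_sub_distrib, Finset.sum_eq_single i]
    · simp
    · intro j _ hj
      simp [hj]
    · simp
  have hQd := hQ di
  simp only [Function.update_eq_self] at hdesc
  rw [blockGrad] at hopt
  linarith
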